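/- arXiv:2311.15492 — 4 statements merged into one kernel-verified Lean document; each statement's English description precedes it below -/
import Mathlib

section
/- Let U and V be filters on ω. If V·V ≡_T V, then U·V ≡_T U × V. If moreover U·U ≡_T U, then U·V ≡_T V·U. -/
open Set

/-- A subset `S` is bounded with respect to the relation `r`. -/
def RelBounded {α : Type*} (r : α → α → Prop) (S : Set α) : Prop :=
  ∃ b, ∀ a ∈ S, r a b

/-- Tukey reducibility between two ordered sets: there is a map sending every
unbounded set to an unbounded set. -/
def TukeyLE {α β : Type*} (ra : α → α → Prop) (rb : β → β → Prop) : Prop :=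
  ∃ f : α → β, ∀ S : Set α, ¬ RelBounded ra S → ¬ RelBounded rb (f '' S)

/-- Tukey equivalence. -/
def TukeyEquiv {α β : Type*} (ra : α → α → Prop) (rb : β → β → Prop) : Prop :=
  TukeyLE ra rb ∧ TukeyLE rb ra

/-- `S` is cofinal with respect to the relation `r`. -/
def IsCofinalIn {α : Type*} (r : α → α → Prop) (S : Set α) : Prop :=
  ∀ a, ∃ b ∈ S, r a b

/-- The poset `(U, ⊇)` associated to a filter `U`: `A ≤ B` iff `A ⊇ B`. -/
def filtRel {X : Type*} (U : Filter X) :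
    {A : Set X // A ∈ U} → {A : Set X // A ∈ U} → Prop :=
  fun A B => B.1 ⊆ A.1

/-- The poset `(I, ⊆)` associated to a family of sets `I`. -/
def subRel {X : Type*} (I : Set (Set X)) :
    {A : Set X // A ∈ I} → {A : Set X // A ∈ I} → Prop :=
  fun A B => A.1 ⊆ B.1

/-- The Fubini product of filters: `A ∈ U·V` iff `{x | (A)_x ∈ V} ∈ U`,
where `(A)_x = {y | (x, y) ∈ A}`. -/
def fubini {X Y : Type*} (U : Filter X) (V : Filter Y) : Filter (X × Y) :=
  U.bind fun x => V.map (Prod.mk x)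

/-- The ω-fold power of an ordered set, with the everywhere (pointwise)
domination order. -/
def seqRel {α : Type*} (r : α → α → Prop) : (ℕ → α) → (ℕ → α) → Prop :=
  fun f g => ∀ n, r (f n) (g n)

/-- The product order on a Cartesian product of two ordered sets. -/
def prodRel {α β : Type*} (ra : α → α → Prop) (rb : β → β → Prop) :
    α × β → α × β → Prop :=
  fun p q => ra p.1 q.1 ∧ rb p.2 q.2

/-- The everywhere domination order on `ω^ω`. -/
def domRel : (ℕ → ℕ) → (ℕ → ℕ) → Prop := fun f g => ∀ n, f n ≤ g n

/-- An ideal on `X`: a family of subsets containing `∅`, closed under subsets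
and finite unions. -/
def IsIdeal {X : Type*} (I : Set (Set X)) : Prop :=
  ∅ ∈ I ∧ (∀ A ∈ I, ∀ B ⊆ A, B ∈ I) ∧ (∀ A ∈ I, ∀ B ∈ I, A ∪ B ∈ I)

/-- `U` has the `I`-pseudo-intersection property: every ω-sequence of members of `U`
has a pseudo-intersection modulo `I` in `U`. -/
def HasPIP {X : Type*} (U : Filter X) (I : Set (Set X)) : Prop :=
  ∀ A : ℕ → Set X, (∀ n, A n ∈ U) → ∃ B ∈ U, ∀ n, B \ A n ∈ I

/-- A p-point: a nonprincipal ultrafilter on `ω` which has the fin-pseudo-intersection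
property. -/
def IsPPoint (U : Ultrafilter ℕ) : Prop :=
  (∀ a : ℕ, (U : Filter ℕ) ≠ pure a) ∧
  ∀ A : ℕ → Set ℕ, (∀ n, A n ∈ U) → ∃ B ∈ U, ∀ n, (B \ A n).Finite

/-- A rapid ultrafilter: a nonprincipal ultrafilter `U` on `ω` such that for every
increasing `f : ω → ω` there is `X ∈ U` with `|X ∩ f(n)| ≤ n` for all `n`. -/
def IsRapid (U : Ultrafilter ℕ) : Prop :=
  (∀ a : ℕ, (U : Filter ℕ) ≠ pure a) ∧
  ∀ f : ℕ → ℕ, StrictMono f → ∃ X ∈ U, ∀ n, (X ∩ Set.Iio (f n)).ncard ≤ n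

/-- The ideal `fin ⊗ fin` on `ω × ω`: all sets with only finitely many infinite
vertical sections. -/
def finOtimesFin : Set (Set (ℕ × ℕ)) :=
  {A | {n : ℕ | {m : ℕ | (n, m) ∈ A}.Infinite}.Finite}

theorem tukeyLE_iff {α β : Type*} {ra : α → α → Prop} {rb : β → β → Prop} :
    TukeyLE ra rb ↔
      ∃ f : α → β, ∀ S : Set α, ∀ b, (∀ a ∈ S, rb (f a) b) → RelBounded ra S := by
  refine exists_congr fun f => forall_congr' fun S => ?_
  rw [not_imp_not]
  constructor
  · intro h b hb
    exact h ⟨b, by rintro _ ⟨a, ha, rfl⟩; exact hb a ha⟩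
  · rintro h ⟨b, hb⟩
    exact h b fun a ha => hb _ ⟨a, ha, rfl⟩

theorem TukeyLE.trans {α β γ : Type*} {ra : α → α → Prop} {rb : β → β → Prop}
    {rc : γ → γ → Prop} (h₁ : TukeyLE ra rb) (h₂ : TukeyLE rb rc) : TukeyLE ra rc := by
  obtain ⟨f, hf⟩ := h₁
  obtain ⟨g, hg⟩ := h₂
  exact ⟨g ∘ f, fun S hS => by rw [image_comp]; exact hg _ (hf _ hS)⟩

theorem TukeyEquiv.symm {α β : Type*} {ra : α → α → Prop} {rb : β → β → Prop}
    (h : TukeyEquiv ra rb) : TukeyEquiv rb ra :=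
  ⟨h.2, h.1⟩

theorem TukeyEquiv.trans {α β γ : Type*} {ra : α → α → Prop} {rb : β → β → Prop}
    {rc : γ → γ → Prop} (h₁ : TukeyEquiv ra rb) (h₂ : TukeyEquiv rb rc) : TukeyEquiv ra rc :=
  ⟨h₁.1.trans h₂.1, h₂.2.trans h₁.2⟩

theorem tukeyLE_prodRel_swap {α β : Type*} (ra : α → α → Prop) (rb : β → β → Prop) :
    TukeyLE (prodRel ra rb) (prodRel rb ra) :=
  tukeyLE_iff.2 ⟨Prod.swap, fun _ b hb => ⟨b.swap, fun a ha => (hb a ha).symm⟩⟩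

theorem TukeyLE.prodRel_left {α β γ : Type*} (ra : α → α → Prop) {rb : β → β → Prop}
    {rc : γ → γ → Prop} (h : TukeyLE rb rc) : TukeyLE (prodRel ra rb) (prodRel ra rc) := by
  obtain ⟨f, hf⟩ := tukeyLE_iff.1 h
  refine tukeyLE_iff.2 ⟨fun p => (p.1, f p.2), fun S b hb => ?_⟩
  obtain ⟨c, hc⟩ := hf (Prod.snd '' S) b.2 (by rintro _ ⟨a, ha, rfl⟩; exact (hb a ha).2)
  exact ⟨(b.1, c), fun a ha => ⟨(hb a ha).1, hc _ ⟨a, ha, rfl⟩⟩⟩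

theorem mem_fubini {X Y : Type*} {U : Filter X} {V : Filter Y} {A : Set (X × Y)} :
    A ∈ fubini U V ↔ {x | Prod.mk x ⁻¹' A ∈ V} ∈ U :=
  Iff.rfl

theorem prodRel_tukeyLE_fubini {X Y : Type*} (U : Filter X) (V : Filter Y) [U.NeBot] [V.NeBot] :
    TukeyLE (prodRel (filtRel U) (filtRel V)) (filtRel (fubini U V)) := by
  refine tukeyLE_iff.2 ⟨fun p => ⟨p.1.1 ×ˢ p.2.1, ?_⟩, fun S C hC => ?_⟩
  · refine mem_fubini.2 (Filter.mem_of_superset p.1.2 fun x hx => ?_)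
    exact Filter.mem_of_superset p.2.2 fun y hy => ⟨hx, hy⟩
  · have hD := mem_fubini.1 C.2
    obtain ⟨x, hx⟩ := Filter.nonempty_of_mem hD
    refine ⟨(⟨_, hD⟩, ⟨_, hx⟩), fun p hp => ⟨fun z hz => ?_, fun y hy => (hC p hp hy).2⟩⟩
    obtain ⟨y, hy⟩ := Filter.nonempty_of_mem hz
    exact (hC p hp hy).1

open Classical in
theorem fubini_tukeyLE_prodRel_seqRel {Y : Type*} (U : Filter ℕ) (V : Filter Y) :
    TukeyLE (filtRel (fubini U V)) (prodRel (filtRel U) (seqRel (filtRel V))) := by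
  refine tukeyLE_iff.2 ⟨fun A => (⟨_, mem_fubini.1 A.2⟩, fun n =>
    if h : Prod.mk n ⁻¹' A.1 ∈ V then ⟨_, h⟩ else ⟨univ, Filter.univ_mem⟩), fun S b hb => ?_⟩
  refine ⟨⟨{p | p.1 ∈ b.1.1 ∧ p.2 ∈ (b.2 p.1).1}, ?_⟩, fun A hA => ?_⟩
  · refine mem_fubini.2 (Filter.mem_of_superset b.1.2 fun x hx => ?_)
    exact Filter.mem_of_superset (b.2 x).2 fun y hy => ⟨hx, hy⟩
  · rintro ⟨x, y⟩ ⟨hx, hy⟩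
    have hxA : Prod.mk x ⁻¹' A.1 ∈ V := (hb A hA).1 hx
    have h := (hb A hA).2 x
    simp only [filtRel, dif_pos hxA] at h
    exact h hy

theorem seqRel_tukeyLE_fubini {Y : Type*} (U : Filter ℕ) (V : Filter Y)
    (hU : ∀ A ∈ U, A.Infinite) :
    TukeyLE (seqRel (filtRel V)) (filtRel (fubini U V)) := by
  refine tukeyLE_iff.2 ⟨fun B => ⟨{p | ∀ i ≤ p.1, p.2 ∈ (B i).1}, ?_⟩, fun S C hC => ?_⟩
  · refine mem_fubini.2 (Filter.univ_mem' fun x => ?_)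
    have h := (Filter.biInter_mem (finite_Iic x)).2 fun i _ => (B i).2
    exact Filter.mem_of_superset h fun y hy i hi => mem_iInter₂.1 hy i hi
  · have hD := hU _ (mem_fubini.1 C.2)
    choose x hx hnx using fun n => hD.exists_gt n
    exact ⟨fun n => ⟨_, hx n⟩, fun B hB n y hy => hC B hB hy n (hnx n).le⟩

theorem Filter.exists_least_of_finite_mem {X : Type*} {V : Filter X} {A : Set X} (hA : A ∈ V)
    (hfin : A.Finite) : ∃ K ∈ V, ∀ B ∈ V, K ⊆ B := by
  obtain ⟨K, hK⟩ := (hfin.finite_subsets.inter_of_left {B | B ∈ V}).exists_minimal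
    ⟨A, Subset.rfl, hA⟩
  refine ⟨K, hK.prop.2, fun B hB => ?_⟩
  have h : K ∩ B ∈ {B | B ⊆ A} ∩ {B | B ∈ V} :=
    ⟨inter_subset_left.trans hK.prop.1, Filter.inter_mem hK.prop.2 hB⟩
  exact (hK.le_of_le h inter_subset_left).trans inter_subset_right

theorem seqRel_tukeyLE_self (V : Filter ℕ)
    (hV : TukeyLE (filtRel (fubini V V)) (filtRel V)) :
    TukeyLE (seqRel (filtRel V)) (filtRel V) := by
  by_cases h : ∀ A ∈ V, A.Infinite
  · exact (seqRel_tukeyLE_fubini V V h).trans hV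
  · push Not at h
    obtain ⟨A, hA, hfin⟩ := h
    obtain ⟨K, hK, hmin⟩ := Filter.exists_least_of_finite_mem hA hfin
    exact tukeyLE_iff.2 ⟨fun B => B 0, fun _ _ _ =>
      ⟨fun _ => ⟨K, hK⟩, fun B _ n => hmin _ (B n).2⟩⟩

theorem fubini_tukeyEquiv_prodRel (U V : Filter ℕ) [U.NeBot] [V.NeBot]
    (hV : TukeyLE (filtRel (fubini V V)) (filtRel V)) :
    TukeyEquiv (filtRel (fubini U V)) (prodRel (filtRel U) (filtRel V)) :=
  ⟨(fubini_tukeyLE_prodRel_seqRel U V).trans ((seqRel_tukeyLE_self V hV).prodRel_left _),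
    prodRel_tukeyLE_fubini U V⟩

/-- If `V·V ≡_T V` then `U·V ≡_T U × V`; if moreover `U·U ≡_T U`,
then `U·V ≡_T V·U`. -/
theorem stmt1 (U V : Filter ℕ) [U.NeBot] [V.NeBot]
    (hV : TukeyEquiv (filtRel (fubini V V)) (filtRel V)) :
    TukeyEquiv (filtRel (fubini U V)) (prodRel (filtRel U) (filtRel V)) ∧
    (TukeyEquiv (filtRel (fubini U U)) (filtRel U) →
      TukeyEquiv (filtRel (fubini U V)) (filtRel (fubini V U))) := by
  have h := fubini_tukeyEquiv_prodRel U V hV.1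
  exact ⟨h, fun hU => (h.trans ⟨tukeyLE_prodRel_swap _ _, tukeyLE_prodRel_swap _ _⟩).trans
    (fubini_tukeyEquiv_prodRel V U hU.1).symm⟩
end

section
/- A nonprincipal ultrafilter U on ω is rapid if and only if the map F : (U, ⊇) → (ω^ω, ≤) defined by F(X)(n) = X(n) (the n-th element of X in increasing order) is a cofinal map, i.e., F maps every cofinal subset of (U, ⊇) to a cofinal subset of (ω^ω, ≤). -/
open Set

/-- Every member of a nonprincipal ultrafilter on `ℕ` is infinite. -/
theorem Ultrafilter.infinite_of_mem_of_ne_pure {U : Ultrafilter ℕ}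
    (hU : ∀ a : ℕ, (U : Filter ℕ) ≠ pure a) {A : Set ℕ} (hA : A ∈ U) : A.Infinite := by
  intro hfin
  obtain ⟨a, -, ha⟩ := Ultrafilter.eq_pure_of_finite_mem hfin hA
  exact hU a (by rw [ha]; rfl)

/-- An infinite set has at most `n` elements below `m` iff its `n`-th element is at least `m`. -/
theorem Set.Infinite.ncard_inter_Iio_le_iff {A : Set ℕ} (hA : A.Infinite) (m n : ℕ) :
    (A ∩ Set.Iio m).ncard ≤ n ↔ m ≤ Nat.nth (· ∈ A) n := by
  classical
  have hcount : (A ∩ Set.Iio m).ncard = Nat.count (· ∈ A) m := by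
    rw [Nat.count_eq_card_filter_range, ← Set.ncard_coe_finset]
    congr 1
    ext x
    simp [and_comm]
  rw [hcount]
  exact Nat.count_le_iff_le_nth (p := (· ∈ A)) hA

/-- A nonprincipal ultrafilter `U` on `ω` is rapid iff the map
`F : (U, ⊇) → (ω^ω, ≤)`, `F(X)(n) = X(n)` (the `n`-th element of `X` in increasing
order), maps every cofinal subset of `(U, ⊇)` to a cofinal subset of `(ω^ω, ≤)`. -/
theorem stmt8 (U : Ultrafilter ℕ) (hU : ∀ a : ℕ, (U : Filter ℕ) ≠ pure a) :
    IsRapid U ↔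
      ∀ S : Set {A : Set ℕ // A ∈ (U : Filter ℕ)},
        IsCofinalIn (filtRel (U : Filter ℕ)) S →
        IsCofinalIn domRel
          ((fun A : {A : Set ℕ // A ∈ (U : Filter ℕ)} =>
            fun n => Nat.nth (· ∈ A.1) n) '' S) := by
  constructor
  · rintro ⟨-, hrapid⟩ S hS g
    have hmono : StrictMono fun n => n + ∑ i ∈ Finset.range (n + 1), g i := by
      refine strictMono_nat_of_lt_succ fun n => ?_
      rw [Finset.sum_range_succ _ (n + 1)]
      omega
    obtain ⟨X, hX, hcard⟩ := hrapid _ hmono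
    obtain ⟨B, hBS, hBX⟩ := hS ⟨X, hX⟩
    refine ⟨_, ⟨B, hBS, rfl⟩, fun n => ?_⟩
    have hle : g n ≤ n + ∑ i ∈ Finset.range (n + 1), g i := by
      rw [Finset.sum_range_succ]
      omega
    refine hle.trans (((Ultrafilter.infinite_of_mem_of_ne_pure hU B.2).ncard_inter_Iio_le_iff _ _).1
      (le_trans ?_ (hcard n)))
    exact Set.ncard_le_ncard (Set.inter_subset_inter_left _ hBX)
      ((Set.finite_Iio _).subset Set.inter_subset_right)
  · refine fun h => ⟨hU, fun f _ => ?_⟩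
    obtain ⟨_, ⟨X, -, rfl⟩, hX⟩ := h Set.univ (fun A => ⟨A, trivial, subset_rfl⟩) f
    exact ⟨X.1, X.2, fun n =>
      ((Ultrafilter.infinite_of_mem_of_ne_pure hU X.2).ncard_inter_Iio_le_iff _ _).2 (hX n)⟩
end

section
/- The ideal fin⊗fin on ω×ω, ordered by ⊆, is Tukey equivalent to (ω^ω, ≤) with the everywhere-domination order. -/
open Set

/-- To show Tukey reducibility it suffices that a set with bounded image is bounded. -/
theorem TukeyLE.of_bounded {α β : Type*} {ra : α → α → Prop} {rb : β → β → Prop} (f : α → β)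
    (h : ∀ b, ∃ a, ∀ x, rb (f x) b → ra x a) : TukeyLE ra rb := by
  refine ⟨f, fun S hS hb => hS ?_⟩
  obtain ⟨b, hb⟩ := hb
  obtain ⟨a, ha⟩ := h b
  exact ⟨a, fun x hx => ha x (hb _ (mem_image_of_mem f hx))⟩

/-- Every member of `fin ⊗ fin` is covered by finitely many vertical lines and the region below
the graph of a function; both are coded by a single element of `ω^ω`. -/
theorem exists_code_of_mem_finOtimesFin {A : Set (ℕ × ℕ)} (hA : A ∈ finOtimesFin) :
    ∃ f : ℕ → ℕ, ∀ p ∈ A, p.1 ≤ f 0 ∨ p.2 ≤ f (p.1 + 1) := by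
  obtain ⟨N, hN⟩ := Set.Finite.bddAbove hA
  have hsec : ∀ n, ∃ b, N < n → ∀ m, (n, m) ∈ A → m ≤ b := by
    intro n
    by_cases hn : {m : ℕ | (n, m) ∈ A}.Infinite
    · exact ⟨0, fun h => absurd (hN hn) h.not_ge⟩
    · obtain ⟨b, hb⟩ := (not_infinite.mp hn).bddAbove
      exact ⟨b, fun _ m hm => hb hm⟩
  choose b hb using hsec
  refine ⟨fun n => Nat.casesOn n N b, fun p hp => ?_⟩
  rcases le_or_gt p.1 N with h | h
  · exact Or.inl h
  · exact Or.inr (hb p.1 h p.2 hp)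

theorem setOf_le_or_le_mem_finOtimesFin (f : ℕ → ℕ) :
    {p : ℕ × ℕ | p.1 ≤ f 0 ∨ p.2 ≤ f (p.1 + 1)} ∈ finOtimesFin := by
  refine (finite_Iic (f 0)).subset fun n hn => ?_
  by_contra h
  exact hn ((finite_Iic (f (n + 1))).subset fun m hm => hm.resolve_left h)

theorem setOf_exists_le_mem_finOtimesFin (f : ℕ → ℕ) :
    {p : ℕ × ℕ | ∃ k ≤ p.1, p.2 ≤ f k} ∈ finOtimesFin := by
  refine finite_empty.subset fun n hn => hn ?_
  refine ((finite_Iic n).biUnion fun k _ => finite_Iic (f k)).subset ?_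
  rintro m ⟨k, hk, hm⟩
  exact mem_biUnion (mem_Iic.mpr hk) hm

/-- A member of `fin ⊗ fin` has finite, hence bounded, sections arbitrarily far out. -/
theorem exists_bounded_section_of_mem_finOtimesFin {B : Set (ℕ × ℕ)} (hB : B ∈ finOtimesFin)
    (k : ℕ) : ∃ b n, k ≤ n ∧ ∀ m, (n, m) ∈ B → m ≤ b := by
  obtain ⟨N, hN⟩ := Set.Finite.bddAbove hB
  have hfin : {m : ℕ | (k + N + 1, m) ∈ B}.Finite := by
    by_contra h
    have : k + N + 1 ≤ N := hN h
    omega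
  obtain ⟨b, hb⟩ := hfin.bddAbove
  exact ⟨b, k + N + 1, by omega, fun m hm => hb hm⟩

/-- `(fin ⊗ fin, ⊆) ≡_T (ω^ω, ≤)`. -/
theorem stmt10 : TukeyEquiv (subRel finOtimesFin) domRel := by
  constructor
  · choose f hf using fun A : {A // A ∈ finOtimesFin} => exists_code_of_mem_finOtimesFin A.2
    refine TukeyLE.of_bounded f fun g => ⟨⟨_, setOf_le_or_le_mem_finOtimesFin g⟩, ?_⟩
    intro A hA p hp
    exact (hf A p hp).imp (fun h => h.trans (hA 0)) fun h => h.trans (hA _)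
  · refine TukeyLE.of_bounded (fun f => ⟨_, setOf_exists_le_mem_finOtimesFin f⟩) fun B => ?_
    choose b n hkn hb using exists_bounded_section_of_mem_finOtimesFin B.2
    exact ⟨b, fun f hf k => hb k (f k) (hf ⟨k, hkn k, le_rfl⟩)⟩
end

section
/- Let U be an ultrafilter on ω×ω such that fin⊗fin ⊆ U*, U has the fin⊗fin-pseudo-intersection property, and U is 2-rapid. Then U·U ≡_T U. -/
open Set

/-- A map for which bounded sets have uniform bounds is Tukey. -/
theorem TukeyLE.of_forall_bounded {α β : Type*} {ra : α → α → Prop} {rb : β → β → Prop}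
    (f : α → β) (h : ∀ b, ∃ c, ∀ a, rb (f a) b → ra a c) : TukeyLE ra rb := by
  refine ⟨f, fun S hS ⟨b, hb⟩ => hS ?_⟩
  obtain ⟨c, hc⟩ := h b
  exact ⟨c, fun a ha => hc a (hb _ (mem_image_of_mem f ha))⟩

theorem tukeyLE_fubini {X Y : Type*} (U : Filter X) (V : Filter Y) [V.NeBot] :
    TukeyLE (filtRel U) (filtRel (fubini U V)) := by
  refine TukeyLE.of_forall_bounded
    (fun A => ⟨Prod.fst ⁻¹' A.1, mem_fubini.2 ?_⟩)
    fun B => ⟨⟨_, mem_fubini.1 B.2⟩, fun A hA x hx => ?_⟩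
  · filter_upwards [A.2] with x hx
    exact Filter.univ_mem' fun _ => hx
  · obtain ⟨y, hy⟩ := Filter.nonempty_of_mem hx
    exact hA hy

/-- The set in `fin ⊗ fin` consisting of the first `ψ 0` columns together with the part of
the plane below the graph of `ψ`. -/
def finOtimesFinBasis (ψ : ℕ → ℕ) : Set (ℕ × ℕ) :=
  {p | p.1 < ψ 0 ∨ p.2 ≤ ψ p.1}

theorem finOtimesFinBasis_mono {φ ψ : ℕ → ℕ} (h : ∀ n, φ n ≤ ψ n) :
    finOtimesFinBasis φ ⊆ finOtimesFinBasis ψ :=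
  fun p hp => hp.imp (fun h' => h'.trans_le (h 0)) fun h' => h'.trans (h p.1)

theorem finOtimesFinBasis_mem (ψ : ℕ → ℕ) : finOtimesFinBasis ψ ∈ finOtimesFin := by
  refine (finite_Iio (ψ 0)).subset fun n hn => ?_
  by_contra hlt
  exact hn ((finite_Iic (ψ n)).subset fun m hm => hm.resolve_left hlt)

theorem exists_subset_finOtimesFinBasis {A : Set (ℕ × ℕ)} (hA : A ∈ finOtimesFin) :
    ∃ ψ, A ⊆ finOtimesFinBasis ψ := by
  obtain ⟨k, hk⟩ := Set.Finite.bddAbove hA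
  have hb : ∀ n, ∃ b, k < n → ∀ m, (n, m) ∈ A → m ≤ b := by
    intro n
    by_cases hn : k < n
    · have hfin : {m | (n, m) ∈ A}.Finite := by
        by_contra h
        exact (hk h).not_gt hn
      obtain ⟨b, hb⟩ := hfin.bddAbove
      exact ⟨b, fun _ m hm => hb hm⟩
    · exact ⟨0, fun h => absurd h hn⟩
  choose φ hφ using hb
  refine ⟨fun n => φ n + (k + 1), fun p hp => ?_⟩
  rcases le_or_gt p.1 k with h | h
  · exact Or.inl (show p.1 < φ 0 + (k + 1) by omega)
  · exact Or.inr ((hφ p.1 h p.2 hp).trans (Nat.le_add_right _ _))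

theorem exists_strictMono_ge (h : ℕ → ℕ) : ∃ f : ℕ → ℕ, StrictMono f ∧ ∀ n, h n ≤ f n := by
  refine ⟨fun n => ∑ i ∈ Finset.range (n + 1), (h i + 1), strictMono_nat_of_lt_succ fun n => ?_,
    fun n => ?_⟩
  · rw [Finset.sum_range_succ _ (n + 1)]
    omega
  · change h n ≤ ∑ i ∈ Finset.range (n + 1), (h i + 1)
    rw [Finset.sum_range_succ]
    omega

/-- Every function is dominated everywhere by the increasing enumerations of all infinite
subsets of some member of a given rapid ultrafilter. -/
theorem IsRapid.exists_le_nth {W : Ultrafilter ℕ} (hW : IsRapid W) (h : ℕ → ℕ) :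
    ∃ X ∈ W, ∀ Y ⊆ X, Y.Infinite → ∀ n, h n ≤ Nat.nth (· ∈ Y) n := by
  classical
  obtain ⟨f, hf, hhf⟩ := exists_strictMono_ge h
  obtain ⟨X, hX, hXf⟩ := hW.2 f hf
  refine ⟨X, hX, fun Y hYX hY n => (hhf n).trans ?_⟩
  rw [← Nat.count_le_iff_le_nth (p := (· ∈ Y)) hY]
  refine le_trans ?_ (hXf n)
  rw [Nat.count_eq_card_filter_range, ← Set.ncard_coe_finset]
  refine Set.ncard_le_ncard (fun m hm => ?_) ((finite_Iio (f n)).inter_of_right X)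
  simp only [Finset.coe_filter, Finset.mem_range, mem_ofPred_eq] at hm
  exact ⟨hYX hm.2, hm.1⟩

theorem infinite_image_fst {U : Ultrafilter (ℕ × ℕ)} (hdual : ∀ A ∈ finOtimesFin, Aᶜ ∈ U)
    {D : Set (ℕ × ℕ)} (hD : D ∈ U) : (Prod.fst '' D).Infinite := by
  intro hfin
  refine Ultrafilter.compl_notMem_iff.2 hD (hdual D (hfin.subset fun n hn => ?_))
  obtain ⟨m, hm⟩ := Set.Infinite.nonempty hn
  exact ⟨(n, m), hm, rfl⟩

/-- Every member of `U·U` is controlled by a member of `U` together with a sequence of sets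
in `fin ⊗ fin`. -/
theorem exists_mem_forall_diff_subset {U : Filter (ℕ × ℕ)} (hpip : HasPIP U finOtimesFin)
    {A : Set ((ℕ × ℕ) × (ℕ × ℕ))} (hA : A ∈ fubini U U) :
    ∃ C ∈ U, ∃ ψ : ℕ × ℕ → ℕ → ℕ,
      ∀ x ∈ C, C \ Prod.mk x ⁻¹' A ⊆ finOtimesFinBasis (ψ x) := by
  obtain ⟨B, hB, hBA⟩ := hpip
    (fun k => {y | Prod.mk (Nat.unpair k) ⁻¹' A ∈ U → (Nat.unpair k, y) ∈ A}) fun k => by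
      by_cases h : Prod.mk (Nat.unpair k) ⁻¹' A ∈ U
      · exact Filter.mem_of_superset h fun y hy _ => hy
      · exact Filter.univ_mem' fun y h' => absurd h' h
  choose ψ hψ using fun k => exists_subset_finOtimesFinBasis (hBA k)
  refine ⟨_, Filter.inter_mem (mem_fubini.1 hA) hB, fun x => ψ (Nat.pair x.1 x.2),
    fun x hx y hy => hψ (Nat.pair x.1 x.2) ⟨hy.1.2, fun h => hy.2 ?_⟩⟩
  simp only [Nat.unpair_pair] at h
  exact h hx.1

theorem fubini_self_tukeyLE {U : Ultrafilter (ℕ × ℕ)} (hdual : ∀ A ∈ finOtimesFin, Aᶜ ∈ U)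
    (hpip : HasPIP (U : Filter (ℕ × ℕ)) finOtimesFin)
    (hrapid : IsRapid (Ultrafilter.map Prod.fst U)) :
    TukeyLE (filtRel (fubini (U : Filter (ℕ × ℕ)) (U : Filter (ℕ × ℕ))))
      (filtRel (U : Filter (ℕ × ℕ))) := by
  choose C hC ψ hψ using fun A : {A // A ∈ fubini (U : Filter (ℕ × ℕ)) (U : Filter (ℕ × ℕ))} =>
    exists_mem_forall_diff_subset hpip A.2
  choose X hX hXψ using fun A => hrapid.exists_le_nth fun k =>
    ψ A (Nat.unpair (Nat.unpair k).1) (Nat.unpair k).2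
  let g (D : Set (ℕ × ℕ)) (x : ℕ × ℕ) (n : ℕ) : ℕ :=
    Nat.nth (· ∈ Prod.fst '' D) (Nat.pair (Nat.pair x.1 x.2) n)
  refine TukeyLE.of_forall_bounded
    (fun A => ⟨C A ∩ Prod.fst ⁻¹' X A, Filter.inter_mem (hC A) (hX A)⟩)
    fun D => ⟨⟨{p | p.1 ∈ D.1 ∧ p.2 ∈ D.1 \ finOtimesFinBasis (g D.1 p.1)},
      mem_fubini.2 ?_⟩, fun A hA p hp => ?_⟩
  · filter_upwards [D.2] with x hx
    filter_upwards [D.2, hdual _ (finOtimesFinBasis_mem (g D.1 x))] with y hy hy'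
    exact ⟨hx, hy, hy'⟩
  · by_contra hpA
    refine hp.2.2 (finOtimesFinBasis_mono (fun n => ?_)
      (hψ A p.1 (hA hp.1).1 ⟨(hA hp.2.1).1, hpA⟩))
    have := hXψ A (Prod.fst '' D.1) (image_subset_iff.2 fun q hq => (hA hq).2)
      (infinite_image_fst hdual D.2) (Nat.pair (Nat.pair p.1.1 p.1.2) n)
    simpa only [Nat.unpair_pair] using this

/-- If `U` is an ultrafilter on `ω × ω` with `fin⊗fin ⊆ U*`, `U` has
the `fin⊗fin`-pseudo-intersection property, and `U` is 2-rapid (the projection of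
`U` to the first coordinate is rapid), then `U·U ≡_T U`. -/
theorem stmt12 (U : Ultrafilter (ℕ × ℕ))
    (hdual : ∀ A ∈ finOtimesFin, Aᶜ ∈ U)
    (hpip : HasPIP (U : Filter (ℕ × ℕ)) finOtimesFin)
    (hrapid : IsRapid (Ultrafilter.map Prod.fst U)) :
    TukeyEquiv (filtRel (fubini (U : Filter (ℕ × ℕ)) (U : Filter (ℕ × ℕ))))
      (filtRel (U : Filter (ℕ × ℕ))) := by
  exact ⟨fubini_self_tukeyLE hdual hpip hrapid, tukeyLE_fubini _ _⟩
end
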